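/- There exists an inescapable group: there exist a group G, a natural number m ≥ 1, and a map g : Fin m → G such that G is infinite, the range of g generates G and is closed under inverses, and for every computable function s : ℕ → Fin m there exist natural numbers N₁ < N₂ with ∏_{j=0}^{N₁−1} g(s j) = ∏_{j=0}^{N₂−1} g(s j), i.e., every computable infinite sequence of generators corresponds to a self-intersecting path in the Cayley graph. -/

import Mathlib

/-- `(G, g)` is an inescapable group: `G` is infinite, the range of `g : Fin m → G`
generates `G` and is closed under inverses, and every computable sequence of
generators traces out a self-intersecting path of partial products in the
Cayley graph. -/
def IsInescapable (G : Type) [Group G] (m : ℕ) (g : Fin m → G) : Prop :=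
  Infinite G ∧ Subgroup.closure (Set.range g) = ⊤ ∧
    (∀ i : Fin m, ∃ i' : Fin m, g i' = (g i)⁻¹) ∧
    ∀ s : ℕ → Fin m, Computable s →
      ∃ N₁ N₂ : ℕ, N₁ < N₂ ∧
        ((List.range N₁).map (fun j => g (s j))).prod =
        ((List.range N₂).map (fun j => g (s j))).prod


namespace Inesc
open Module

abbrev T := MonoidAlgebra (ZMod 2) (FreeMonoid (Fin 6))

noncomputable def W (w : FreeMonoid (Fin 6)) : T := MonoidAlgebra.of (ZMod 2) _ w

lemma W_mul (u v : FreeMonoid (Fin 6)) : W (u * v) = W u * W v := map_mul _ _ _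
lemma W_one : W 1 = 1 := map_one _

lemma li_W : LinearIndependent (ZMod 2) W := by
  have := (Finsupp.basisSingleOne (R := ZMod 2) (ι := FreeMonoid (Fin 6))).map
    (MonoidAlgebra.coeffLinearEquiv (R := ZMod 2)).symm
  have h2 := ((Finsupp.basisSingleOne (R := ZMod 2) (ι := FreeMonoid (Fin 6))).map
    (MonoidAlgebra.coeffLinearEquiv (R := ZMod 2) (S := ZMod 2)).symm).linearIndependent
  convert h2 using 1
  ext w : 1
  simp [W]

lemma span_W : Submodule.span (ZMod 2) (Set.range W) = ⊤ := by
  have h2 := ((Finsupp.basisSingleOne (R := ZMod 2) (ι := FreeMonoid (Fin 6))).map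
    (MonoidAlgebra.coeffLinearEquiv (R := ZMod 2) (S := ZMod 2)).symm).span_eq
  convert h2 using 3
  ext w : 1
  simp [W]

@[elab_as_elim]
lemma T_ind {p : T → Prop} (x : T) (h0 : p 0) (hW : ∀ w, p (W w))
    (hadd : ∀ x y, p x → p y → p (x + y)) (hs : ∀ (c : ZMod 2) x, p x → p (c • x)) : p x := by
  have hx : x ∈ Submodule.span (ZMod 2) (Set.range W) := by rw [span_W]; trivial
  induction hx using Submodule.span_induction with
  | mem x h => obtain ⟨w, rfl⟩ := h; exact hW w
  | zero => exact h0
  | add x y _ _ h1 h2 => exact hadd _ _ h1 h2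
  | smul c x _ h => exact hs _ _ h

noncomputable def pr (n : ℕ) : T →ₗ[ZMod 2] T :=
  (Finsupp.linearCombination (ZMod 2)
    (fun w : FreeMonoid (Fin 6) => if w.length = n then W w else 0)) ∘ₗ
  (MonoidAlgebra.coeffLinearEquiv (R := ZMod 2) (S := ZMod 2)).toLinearMap

lemma pr_W (n : ℕ) (w) : pr n (W w) = if w.length = n then W w else 0 := by
  simp only [pr, LinearMap.comp_apply, W]
  erw [Finsupp.linearCombination_single]
  simp

noncomputable def Hm (n : ℕ) : Submodule (ZMod 2) T :=
  Submodule.span (ZMod 2) (Set.range fun w : {w : FreeMonoid (Fin 6) // w.length = n} => W w.1)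

lemma W_mem (w : FreeMonoid (Fin 6)) {n} (h : w.length = n) : W w ∈ Hm n :=
  Submodule.subset_span ⟨⟨w, h⟩, rfl⟩

instance finWords (n : ℕ) : Fintype {w : FreeMonoid (Fin 6) // w.length = n} :=
  inferInstanceAs (Fintype (List.Vector (Fin 6) n))

lemma finrank_Hm (n : ℕ) : finrank (ZMod 2) (Hm n) = 6 ^ n := by
  unfold Hm
  rw [finrank_span_eq_card]
  · have := card_vector (α := Fin 6) n
    rw [Fintype.card_fin] at this
    exact this
  · exact li_W.comp _ Subtype.val_injective

instance (n : ℕ) : Module.Finite (ZMod 2) (Hm n) := by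
  unfold Hm
  exact Module.Finite.span_of_finite _ (Set.finite_range _)

lemma pr_mem (n : ℕ) (x : T) : pr n x ∈ Hm n := by
  induction x using T_ind with
  | h0 => simp
  | hW w =>
    rw [pr_W]; split_ifs with h
    · exact W_mem w h
    · exact zero_mem _
  | hadd x y h1 h2 => rw [map_add]; exact add_mem h1 h2
  | hs c x h => rw [map_smul]; exact Submodule.smul_mem _ _ h

lemma pr_same {n : ℕ} {x : T} (hx : x ∈ Hm n) : pr n x = x := by
  unfold Hm at hx
  induction hx using Submodule.span_induction with
  | mem x h => obtain ⟨⟨w, hw⟩, rfl⟩ := h; simp [pr_W, hw]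
  | zero => simp
  | add x y _ _ h1 h2 => rw [map_add, h1, h2]
  | smul c x _ h => rw [map_smul, h]

lemma pr_ne {n k : ℕ} {x : T} (hx : x ∈ Hm n) (hk : n ≠ k) : pr k x = 0 := by
  unfold Hm at hx
  induction hx using Submodule.span_induction with
  | mem x h => obtain ⟨⟨w, hw⟩, rfl⟩ := h; simp [pr_W, hw, hk]
  | zero => simp
  | add x y _ _ h1 h2 => rw [map_add, h1, h2, add_zero]
  | smul c x _ h => rw [map_smul, h, smul_zero]

lemma mul_mem_Hm {a b : ℕ} {x y : T} (hx : x ∈ Hm a) (hy : y ∈ Hm b) : x * y ∈ Hm (a + b) := by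
  have h : Hm a * Hm b ≤ Hm (a + b) := by
    unfold Hm
    rw [Submodule.span_mul_span, Submodule.span_le]
    rintro _ ⟨_, ⟨⟨u, hu⟩, rfl⟩, _, ⟨⟨v, hv⟩, rfl⟩, rfl⟩
    simp only [← W_mul]
    exact W_mem _ (by simp [hu, hv])
  exact h (Submodule.mul_mem_mul hx hy)

lemma sum_pr (x : T) : ∃ N, ∀ M, N ≤ M → x = ∑ d ∈ Finset.range M, pr d x := by
  induction x using T_ind with
  | h0 => exact ⟨0, by simp⟩
  | hW w =>
    refine ⟨w.length + 1, fun M hM => ?_⟩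
    simp only [pr_W]
    rw [Finset.sum_ite_eq, if_pos (Finset.mem_range.2 (by omega))]
  | hadd x y h1 h2 =>
    obtain ⟨N1, h1⟩ := h1
    obtain ⟨N2, h2⟩ := h2
    refine ⟨max N1 N2, fun M hM => ?_⟩
    simp only [map_add, Finset.sum_add_distrib]
    rw [← h1 M (by omega), ← h2 M (by omega)]
  | hs c x h =>
    obtain ⟨N, h⟩ := h
    refine ⟨N, fun M hM => ?_⟩
    simp only [map_smul, ← Finset.smul_sum]
    rw [← h M hM]

/-- homogeneous part of the ideal -/
noncomputable def In (f : ℕ → Fin 6 → T) (n : ℕ) : Submodule (ZMod 2) T :=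
  Submodule.span (ZMod 2) {x | ∃ u v d i, 2 ≤ d ∧ u.length + d + v.length = n ∧
    x = W u * f d i * W v}

noncomputable def Ia (f : ℕ → Fin 6 → T) : Submodule (ZMod 2) T :=
  Submodule.span (ZMod 2) {x | ∃ u v d i, 2 ≤ d ∧ x = W u * f d i * W v}

variable {f : ℕ → Fin 6 → T}

lemma In_le (hf : ∀ d i, f d i ∈ Hm d) (n : ℕ) : In f n ≤ Hm n := by
  unfold In
  rw [Submodule.span_le]
  rintro _ ⟨u, v, d, i, hd, hn, rfl⟩
  subst hn
  exact mul_mem_Hm (mul_mem_Hm (W_mem u rfl) (hf d i)) (W_mem v rfl)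

lemma pr_Ia (hf : ∀ d i, f d i ∈ Hm d) (n : ℕ) {x : T} (hx : x ∈ Ia f) : pr n x ∈ In f n := by
  unfold Ia at hx
  induction hx using Submodule.span_induction with
  | mem x h =>
    obtain ⟨u, v, d, i, hd, rfl⟩ := h
    have := mul_mem_Hm (mul_mem_Hm (W_mem u rfl) (hf d i)) (W_mem v rfl)
    by_cases h : u.length + d + v.length = n
    · subst h
      rw [pr_same this]
      exact Submodule.subset_span ⟨u, v, d, i, hd, rfl, rfl⟩
    · rw [pr_ne this h]
      exact zero_mem _
  | zero => simp
  | add x y _ _ h1 h2 => rw [map_add]; exact add_mem h1 h2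
  | smul c x _ h => rw [map_smul]; exact Submodule.smul_mem _ _ h

lemma In_mul_W {n : ℕ} {x : T} (hx : x ∈ In f n) (w : FreeMonoid (Fin 6)) :
    x * W w ∈ In f (n + w.length) := by
  unfold In at hx
  induction hx using Submodule.span_induction with
  | mem x h =>
    obtain ⟨u, v, d, i, hd, hn, rfl⟩ := h
    refine Submodule.subset_span ⟨u, v * w, d, i, hd, ?_, ?_⟩
    · simp; omega
    · rw [W_mul]; simp only [mul_assoc]
  | zero => simp
  | add x y _ _ h1 h2 => rw [add_mul]; exact add_mem h1 h2
  | smul c x _ h => rw [smul_mul_assoc]; exact Submodule.smul_mem _ _ h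

lemma finrank_iSup_le' {ι : Type*} [Fintype ι] (S : ι → Submodule (ZMod 2) T)
    [∀ i, Module.Finite (ZMod 2) (S i)] :
    finrank (ZMod 2) (⨆ i, S i : Submodule (ZMod 2) T) ≤ ∑ i, finrank (ZMod 2) (S i) := by
  classical
  have : ∀ s : Finset ι, finrank (ZMod 2) (s.sup S : Submodule (ZMod 2) T) ≤
      ∑ i ∈ s, finrank (ZMod 2) (S i) := by
    intro s
    induction s using Finset.induction_on with
    | empty => simp
    | insert a s ha ih =>
      rw [Finset.sup_insert, Finset.sum_insert ha]
      exact (Submodule.finrank_add_le_finrank_add_finrank _ _).trans (by omega)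
  rw [← Finset.sup_univ_eq_iSup]
  exact this _

noncomputable def X (i : Fin 6) : T := W (FreeMonoid.of i)

lemma exists_snoc (w : FreeMonoid (Fin 6)) (h : w.length ≠ 0) :
    ∃ w' i, w = w' * FreeMonoid.of i ∧ w.length = w'.length + 1 := by
  induction w using List.reverseRecOn with
  | nil => exact absurd rfl h
  | append_singleton l a _ =>
    exact ⟨FreeMonoid.ofList l, a, rfl, List.length_append ..⟩

lemma exists_compl (hf : ∀ d i, f d i ∈ Hm d) (n : ℕ) : ∃ C : Submodule (ZMod 2) T,
    In f n ⊔ C = Hm n ∧ finrank (ZMod 2) C + finrank (ZMod 2) (In f n) = 6 ^ n := by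
  obtain ⟨Q, hQ⟩ := Submodule.exists_isCompl (In f n)
  have h1 : In f n ⊔ (Q ⊓ Hm n) = Hm n := by
    rw [← sup_inf_assoc_of_le _ (In_le hf n), hQ.sup_eq_top, top_inf_eq]
  refine ⟨Q ⊓ Hm n, h1, ?_⟩
  have : Module.Finite (ZMod 2) (In f n) := Submodule.finiteDimensional_of_le (In_le hf n)
  have : Module.Finite (ZMod 2) (Q ⊓ Hm n : Submodule (ZMod 2) T) :=
    Submodule.finiteDimensional_of_le inf_le_right
  have h2 := Submodule.finrank_sup_add_finrank_inf_eq (In f n) (Q ⊓ Hm n)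
  rw [h1, finrank_Hm, ← inf_assoc, hQ.inf_eq_bot, bot_inf_eq, finrank_bot] at h2
  omega

lemma rec_ineq (hf : ∀ d i, f d i ∈ Hm d) (C : ℕ → Submodule (ZMod 2) T)
    (hC : ∀ n, In f n ⊔ C n = Hm n) (n : ℕ) :
    finrank (ZMod 2) (In f (n + 1)) ≤ 6 * finrank (ZMod 2) (In f n) +
      6 * ∑ k ∈ Finset.range n, finrank (ZMod 2) (C k) := by
  have hI : ∀ n, Module.Finite (ZMod 2) (In f n) :=
    fun n => Submodule.finiteDimensional_of_le (In_le hf n)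
  have hCf : ∀ n, Module.Finite (ZMod 2) (C n) :=
    fun n => Submodule.finiteDimensional_of_le (S₂ := Hm n) (by rw [← hC]; exact le_sup_right)
  let A : Fin 6 → Submodule (ZMod 2) T := fun i =>
    (In f n).map (LinearMap.mulRight (ZMod 2) (X i))
  let B : Fin n × Fin 6 → Submodule (ZMod 2) T := fun p =>
    (C p.1).map (LinearMap.mulRight (ZMod 2) (f (n + 1 - p.1) p.2))
  have hA : ∀ (w : FreeMonoid (Fin 6)) (k : ℕ) (x : T), x ∈ In f k → w.length ≠ 0 →
      k + w.length = n + 1 → x * W w ∈ (⨆ i, A i) := by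
    intro w k x hx hw hk
    obtain ⟨w', i, rfl, hl⟩ := exists_snoc w hw
    refine Submodule.mem_iSup_of_mem i ⟨x * W w', ?_, ?_⟩
    · have := In_mul_W hx w'
      rwa [show k + w'.length = n by omega] at this
    · simp [LinearMap.mulRight_apply, X, W_mul, mul_assoc]
  have hA2 : ∀ (d k : ℕ) (x y : T), x ∈ In f k → 2 ≤ d → k + d = n + 1 → y ∈ Hm d →
      x * y ∈ (⨆ i, A i) := by
    intro d k x y hx hd hk hy
    unfold Hm at hy
    induction hy using Submodule.span_induction with
    | mem y h =>
      obtain ⟨⟨w, hw⟩, rfl⟩ := h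
      exact hA w k x hx (by omega) (by omega)
    | zero => simp
    | add x y _ _ h1 h2 => rw [mul_add]; exact add_mem h1 h2
    | smul c x _ h => rw [mul_smul_comm]; exact Submodule.smul_mem _ _ h
  have hle : In f (n + 1) ≤ (⨆ i, A i) ⊔ (⨆ p, B p) := by
    conv_lhs => unfold In
    rw [Submodule.span_le]
    rintro _ ⟨u, v, d, i, hd, hn, rfl⟩
    by_cases hv : v.length = 0
    · have hv1 : v = 1 := List.eq_nil_of_length_eq_zero hv
      subst hv1
      rw [W_one, mul_one]
      have hu := W_mem u rfl
      rw [← hC, Submodule.mem_sup] at hu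
      obtain ⟨y, hy, z, hz, hyz⟩ := hu
      rw [← hyz, add_mul]
      refine add_mem (Submodule.mem_sup_left (hA2 d _ y _ hy hd (by omega) (hf d i)))
        (Submodule.mem_sup_right ?_)
      refine Submodule.mem_iSup_of_mem (⟨u.length, by omega⟩, i) ⟨z, hz, ?_⟩
      simp only [LinearMap.mulRight_apply]
      congr 2
      omega
    · refine Submodule.mem_sup_left (hA v (u.length + d) _ ?_ hv hn)
      exact Submodule.subset_span ⟨u, 1, d, i, hd, rfl, by rw [W_one, mul_one]⟩
  calc _ ≤ finrank (ZMod 2) ((⨆ i, A i) ⊔ (⨆ p, B p) : Submodule (ZMod 2) T) :=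
        Submodule.finrank_mono hle
    _ ≤ finrank (ZMod 2) (⨆ i, A i : Submodule (ZMod 2) T)
        + finrank (ZMod 2) (⨆ p, B p : Submodule (ZMod 2) T) :=
        Submodule.finrank_add_le_finrank_add_finrank _ _
    _ ≤ ∑ i, finrank (ZMod 2) (A i) + ∑ p, finrank (ZMod 2) (B p) :=
        add_le_add (finrank_iSup_le' A) (finrank_iSup_le' B)
    _ ≤ ∑ i : Fin 6, finrank (ZMod 2) (In f n) +
        ∑ p : Fin n × Fin 6, finrank (ZMod 2) (C p.1) :=
        add_le_add (Finset.sum_le_sum fun i _ => Submodule.finrank_map_le _ _)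
          (Finset.sum_le_sum fun i _ => Submodule.finrank_map_le _ _)
    _ = _ := by
      rw [Fintype.sum_prod_type]
      rw [Finset.sum_range, Finset.mul_sum]
      congr 1
      · simp
      · refine Finset.sum_congr rfl fun k _ => ?_
        change ∑ _y : Fin 6, finrank (ZMod 2) (C k) = _
        rw [Finset.sum_const, Finset.card_univ, Fintype.card_fin, smul_eq_mul]

lemma In_ne (hf : ∀ d i, f d i ∈ Hm d) (n : ℕ) : ∃ w, w.length = n ∧ W w ∉ In f n := by
  choose C hC hr using exists_compl hf
  have key : ∀ n, 0 < finrank (ZMod 2) (C n) ∧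
      2 * ∑ k ∈ Finset.range n, finrank (ZMod 2) (C k) ≤ finrank (ZMod 2) (C n) := by
    intro n
    induction n with
    | zero =>
      have : In f 0 = ⊥ := by
        unfold In
        rw [Submodule.span_eq_bot]
        rintro _ ⟨u, v, d, i, hd, hn, rfl⟩
        omega
      have h := hr 0
      rw [this, finrank_bot] at h
      simp at h ⊢
      omega
    | succ n ih =>
      have h1 := rec_ineq hf C hC n
      have h2 := hr n
      have h3 := hr (n + 1)
      rw [pow_succ] at h3
      rw [Finset.sum_range_succ]
      omega
  by_contra! hcon
  have h1 : Hm n ≤ In f n := by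
    conv_lhs => unfold Hm
    rw [Submodule.span_le]
    rintro _ ⟨⟨w, hw⟩, rfl⟩
    exact hcon w hw
  have h2 := hr n
  rw [le_antisymm (In_le hf n) h1, finrank_Hm] at h2
  have := (key n).1
  omega

lemma Ia_mul_left (x : T) {y : T} (hy : y ∈ Ia f) : x * y ∈ Ia f := by
  induction x using T_ind with
  | h0 => simp
  | hW w =>
    unfold Ia at hy
    induction hy using Submodule.span_induction with
    | mem x h =>
      obtain ⟨u, v, d, i, hd, rfl⟩ := h
      exact Submodule.subset_span ⟨w * u, v, d, i, hd, by rw [W_mul]; simp only [mul_assoc]⟩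
    | zero => simp
    | add x y _ _ h1 h2 => rw [mul_add]; exact add_mem h1 h2
    | smul c x _ h => rw [mul_smul_comm]; exact Submodule.smul_mem _ _ h
  | hadd x y h1 h2 => rw [add_mul]; exact add_mem h1 h2
  | hs c x h => rw [smul_mul_assoc]; exact Submodule.smul_mem _ _ h

lemma Ia_mul_right (x : T) {y : T} (hy : y ∈ Ia f) : y * x ∈ Ia f := by
  induction x using T_ind with
  | h0 => simp
  | hW w =>
    unfold Ia at hy
    induction hy using Submodule.span_induction with
    | mem x h =>
      obtain ⟨u, v, d, i, hd, rfl⟩ := h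
      exact Submodule.subset_span ⟨u, v * w, d, i, hd, by rw [W_mul]; simp only [mul_assoc]⟩
    | zero => simp
    | add x y _ _ h1 h2 => rw [add_mul]; exact add_mem h1 h2
    | smul c x _ h => rw [smul_mul_assoc]; exact Submodule.smul_mem _ _ h
  | hadd x y h1 h2 => rw [mul_add]; exact add_mem h1 h2
  | hs c x h => rw [mul_smul_comm]; exact Submodule.smul_mem _ _ h

/-- the two-sided ideal -/
noncomputable def J (f : ℕ → Fin 6 → T) : Ideal T where
  carrier := Ia f
  add_mem' := add_mem
  zero_mem' := zero_mem _
  smul_mem' c _ h := Ia_mul_left c h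

lemma mem_J {x : T} : x ∈ J f ↔ x ∈ Ia f := Iff.rfl

instance : (J f).IsTwoSided := ⟨fun b h => Ia_mul_right b h⟩

lemma quot_infinite (hf : ∀ d i, f d i ∈ Hm d) : Infinite (T ⧸ J f) := by
  choose w hw hn using In_ne hf
  refine Infinite.of_injective (fun n => Ideal.Quotient.mk (J f) (W (w n))) ?_
  intro a b hab
  by_contra hne
  have h : W (w a) - W (w b) ∈ J f := Ideal.Quotient.eq.1 hab
  have h2 := pr_Ia hf a (mem_J.1 h)
  rw [map_sub, pr_W, pr_W, if_pos (hw a), if_neg (by rw [hw b]; exact fun h => hne h.symm),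
    sub_zero] at h2
  exact hn a h2

lemma countable_comp : Countable {s : ℕ → Fin 6 // Computable s} := by
  refine Function.Injective.countable
    (β := {f : ℕ → ℕ // Computable f}) (f := fun s => ⟨fun n => (s.1 n : ℕ), ?_⟩) ?_
  · exact (Primrec.fin_val.to_comp).comp s.2
  · intro s t h
    ext n
    exact congrFun (congrArg Subtype.val h) n

noncomputable def P (s : ℕ → Fin 6) (n : ℕ) : T := ((List.range n).map fun j => 1 + X (s j)).prod

instance (n : ℕ) : Finite (Hm n) := Module.finite_of_finite (ZMod 2)

lemma pigeon (s : ℕ → Fin 6) (n : ℕ) : ∃ i j M, i < j ∧ n ≤ M ∧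
    P s i - P s j = ∑ d ∈ Finset.Ico n M, pr d (P s i - P s j) := by
  obtain ⟨i, j, hne, h⟩ := Finite.exists_ne_map_eq_of_infinite
    (fun j : ℕ => fun d : Fin n => (⟨pr d (P s j), pr_mem _ _⟩ : Hm d))
  wlog hij : i < j generalizing i j
  · exact this j i hne.symm h.symm (by omega)
  obtain ⟨N, hN⟩ := sum_pr (P s i - P s j)
  refine ⟨i, j, max n N, hij, le_max_left _ _, ?_⟩
  conv_lhs => rw [hN (max n N) (le_max_right _ _)]
  rw [← Finset.sum_range_add_sum_Ico _ (le_max_left n N), add_eq_right]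
  refine Finset.sum_eq_zero fun d hd => ?_
  have := congrArg Subtype.val (congrFun h ⟨d, Finset.mem_range.1 hd⟩)
  simp only at this
  rw [map_sub, this, sub_self]

lemma exists_f : ∃ f : ℕ → Fin 6 → T, (∀ d i, f d i ∈ Hm d) ∧ (∀ i, X i * X i ∈ Ia f) ∧
    ∀ s, Computable s → ∃ i j, i < j ∧ P s i - P s j ∈ Ia f := by
  have := countable_comp
  have : Nonempty {s : ℕ → Fin 6 // Computable s} := ⟨⟨fun _ => 0, Computable.const 0⟩⟩
  obtain ⟨e, he⟩ := exists_surjective_nat {s : ℕ → Fin 6 // Computable s}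
  choose a b M hab hM hsum using pigeon
  let N : ℕ → ℕ := fun k => Nat.rec 3 (fun k r => M (e k).1 r) k
  have hNs : ∀ k, N (k + 1) = M (e k).1 (N k) := fun k => rfl
  have hmono : Monotone N := monotone_nat_of_le_succ fun k => by rw [hNs]; exact hM _ _
  have h3 : ∀ k, 3 ≤ N k := fun k => hmono (Nat.zero_le k)
  have hex : ∀ d, ∃ y : T, y ∈ Hm d ∧ ∀ k, N k ≤ d → d < N (k + 1) →
      pr d (P (e k).1 (a (e k).1 (N k)) - P (e k).1 (b (e k).1 (N k))) = y := by
    intro d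
    rcases Classical.em (∃ k, N k ≤ d ∧ d < N (k + 1)) with h | h
    · obtain ⟨k, hk1, hk2⟩ := h
      refine ⟨_, pr_mem d (P (e k).1 (a (e k).1 (N k)) - P (e k).1 (b (e k).1 (N k))),
        fun k' h1 h2 => ?_⟩
      · have : k' = k := by
          rcases lt_trichotomy k' k with h | h | h
          · have := hmono (show k' + 1 ≤ k from h); omega
          · exact h
          · have := hmono (show k + 1 ≤ k' from h); omega
        rw [this]
    · push Not at h
      exact ⟨0, zero_mem _, fun k h1 h2 => absurd (h k h1) (by omega)⟩
  choose y hy hyk using hex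
  let f : ℕ → Fin 6 → T := fun d i => if d = 2 then X i * X i else y d
  have hfm : ∀ d i, 2 ≤ d → f d i ∈ Ia f := fun d i hd =>
    Submodule.subset_span ⟨1, 1, d, i, hd, by rw [W_one, mul_one, one_mul]⟩
  refine ⟨f, ?_, ?_, ?_⟩
  · intro d i
    by_cases hd : d = 2
    · subst hd
      simp only [f, if_true]
      exact mul_mem_Hm (a := 1) (b := 1) (W_mem _ (by simp)) (W_mem _ (by simp))
    · simp only [f, if_neg hd]
      exact hy d
  · intro i
    simpa [f] using hfm 2 i le_rfl
  · intro s hs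
    obtain ⟨k, hk⟩ := he ⟨s, hs⟩
    refine ⟨a s (N k), b s (N k), hab _ _, ?_⟩
    rw [hsum]
    refine Submodule.sum_mem _ fun d hd => ?_
    rw [Finset.mem_Ico] at hd
    have h1 := hyk d k hd.1 (by rw [hNs, hk]; exact hd.2)
    rw [hk] at h1
    rw [h1]
    have h2 := hfm d 0 (by have := h3 k; omega)
    have h4 : d ≠ 2 := by have := h3 k; omega
    simpa only [f, if_neg h4] using h2

lemma two_zero (x : T) : x + x = 0 := by
  rw [← two_smul (ZMod 2) x, show (2 : ZMod 2) = 0 from rfl, zero_smul]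

lemma final : ∃ (G : Type) (inst : Group G) (m : ℕ) (g : Fin m → G),
      1 ≤ m ∧ (Infinite G ∧ Subgroup.closure (Set.range g) = ⊤ ∧
    (∀ i : Fin m, ∃ i' : Fin m, g i' = (g i)⁻¹) ∧
    ∀ s : ℕ → Fin m, Computable s →
      ∃ N₁ N₂ : ℕ, N₁ < N₂ ∧
        ((List.range N₁).map (fun j => g (s j))).prod =
        ((List.range N₂).map (fun j => g (s j))).prod) := by
  obtain ⟨f, hf, hX, hs⟩ := exists_f
  have hinf := quot_infinite hf
  let q := Ideal.Quotient.mk (J f)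
  have hsq : ∀ i, q (1 + X i) * q (1 + X i) = 1 := by
    intro i
    rw [← map_mul, ← map_one q]
    refine Ideal.Quotient.eq.2 ?_
    rw [mem_J]
    convert hX i using 1
    have := two_zero (X i)
    calc (1 + X i) * (1 + X i) - 1 = (X i + X i) + X i * X i := by noncomm_ring
      _ = _ := by rw [this, zero_add]
  let u : Fin 6 → (T ⧸ J f)ˣ := fun i => ⟨q (1 + X i), q (1 + X i), hsq i, hsq i⟩
  let H := Subgroup.closure (Set.range u)
  let g : Fin 6 → H := fun i => ⟨u i, Subgroup.subset_closure ⟨i, rfl⟩⟩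
  have hgu : ∀ i, ((g i : (T ⧸ J f)ˣ) : T ⧸ J f) = q (1 + X i) := fun i => rfl
  refine ⟨H, inferInstance, 6, g, by norm_num, ?_, ?_, ?_, ?_⟩
  · by_contra hfin
    rw [not_infinite_iff_finite] at hfin
    let S : Submodule (ZMod 2) (T ⧸ J f) :=
      Submodule.span (ZMod 2) (Set.range fun h : H => ((h : (T ⧸ J f)ˣ) : T ⧸ J f))
    have h1 : (1 : T ⧸ J f) ∈ S := Submodule.subset_span ⟨1, rfl⟩
    have hm : ∀ x ∈ S, ∀ i, x * q (X i) ∈ S := by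
      intro x hx i
      have h2 : x * q (1 + X i) ∈ S := by
        induction hx using Submodule.span_induction with
        | mem x h =>
          obtain ⟨h, rfl⟩ := h
          exact Submodule.subset_span ⟨h * g i, rfl⟩
        | zero => simp
        | add x y _ _ h1 h2 => rw [add_mul]; exact add_mem h1 h2
        | smul c x _ h => rw [smul_mul_assoc]; exact Submodule.smul_mem _ _ h
      rw [map_add, map_one, mul_add, mul_one] at h2
      simpa using sub_mem h2 hx
    have hW : ∀ w : FreeMonoid (Fin 6), q (W w) ∈ S := by
      intro w
      induction w using List.reverseRecOn with
      | nil => exact h1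
      | append_singleton l a ih =>
        change q (W (FreeMonoid.ofList l * FreeMonoid.of a)) ∈ S
        rw [W_mul, map_mul]
        exact hm _ ih a
    have htop : S = ⊤ := by
      rw [eq_top_iff]
      rintro x -
      obtain ⟨x, rfl⟩ := Ideal.Quotient.mk_surjective x
      induction x using T_ind with
      | h0 => simp
      | hW w => exact hW w
      | hadd x y h1 h2 => rw [map_add]; exact add_mem h1 h2
      | hs c x h => exact Submodule.smul_mem S c h
    have : Module.Finite (ZMod 2) (T ⧸ J f) :=
      ⟨htop ▸ Submodule.fg_span (Set.finite_range _)⟩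
    have : Finite (T ⧸ J f) := Module.finite_of_finite (ZMod 2)
    exact not_finite (T ⧸ J f)
  · have h := Subgroup.closure_closure_coe_preimage (k := Set.range u)
    convert h using 2
    ext x
    simp only [Set.mem_range, Set.mem_preimage, Subtype.ext_iff, g]
  · intro i
    refine ⟨i, ?_⟩
    rw [eq_inv_iff_mul_eq_one]
    ext
    exact hsq i
  · intro s hsc
    obtain ⟨i, j, hij, h⟩ := hs s hsc
    refine ⟨i, j, hij, ?_⟩
    have hP : ∀ n, (((((List.range n).map (fun j => g (s j))).prod : H) : (T ⧸ J f)ˣ) : T ⧸ J f)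
        = q (P s n) := by
      intro n
      induction n with
      | zero => simp [P]
      | succ n ih =>
        unfold P at ih ⊢
        rw [List.range_succ, List.map_append, List.map_append, List.prod_append, List.prod_append,
          map_mul, ← ih]
        simp [hgu]
    apply Subtype.ext
    apply Units.ext
    rw [hP, hP]
    exact Ideal.Quotient.eq.2 h

end Inesc

/-- There exists an inescapable group. -/
theorem exists_inescapable_group :
    ∃ (G : Type) (inst : Group G) (m : ℕ) (g : Fin m → G),
      1 ≤ m ∧ @IsInescapable G inst m g := by
  exact Inesc.final
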